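/- Fix R > 0, set ε = 2^R − 1, and fix a transmit SNR P > 0. Let X be a standard exponential random variable. Then the mean number of supported SNR levels admits the series representation E[K(X)] = Σ_{n=1}^{∞} exp(−ε(1+ε)^n/P). -/

import Mathlib

open MeasureTheory ProbabilityTheory Real

/-- Partial sums of the preconfigured SNR levels: `η_n = (1+ε)^n - 1`. -/
noncomputable def eta (ε : ℝ) (n : ℕ) : ℝ := (1 + ε) ^ n - 1

/-- The preconfigured NOMA receive SNR levels: `P_k = ε (1+ε)^(k-1)`. -/
noncomputable def snrLevel (ε : ℝ) (k : ℕ) : ℝ := ε * (1 + ε) ^ (k - 1)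

/-- The interference budget tolerable to the primary user: `I(x) = P x / ε - 1`. -/
noncomputable def budget (ε P x : ℝ) : ℝ := P * x / ε - 1

/-- The number of supported SNR levels: `0` if `I(x) < η_1`, and otherwise
`max {n ≥ 1 : η_n ≤ I(x)}` (in `ℕ`, `sSup ∅ = 0`). -/
noncomputable def numLevels (ε P x : ℝ) : ℕ :=
  sSup {n : ℕ | 1 ≤ n ∧ eta ε n ≤ budget ε P x}

lemma bddAbove_setOf_eta_le {ε : ℝ} (hε : 0 < ε) (b : ℝ) :
    BddAbove {n : ℕ | 1 ≤ n ∧ eta ε n ≤ b} := by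
  obtain ⟨N, hN⟩ := pow_unbounded_of_one_lt (b + 1) (by linarith : 1 < 1 + ε)
  refine ⟨N, fun n hn ↦ ?_⟩
  by_contra! hlt
  have hpow : (1 + ε) ^ N ≤ (1 + ε) ^ n := pow_le_pow_right₀ (by linarith) hlt.le
  have hle := hn.2
  rw [eta] at hle
  linarith

lemma eta_le_budget_iff {ε P : ℝ} (hε : 0 < ε) (hP : 0 < P) (x : ℝ) (n : ℕ) :
    eta ε n ≤ budget ε P x ↔ ε * (1 + ε) ^ n / P ≤ x := by
  rw [eta, budget, sub_le_sub_iff_right, le_div_iff₀ hε, div_le_iff₀ hP, mul_comm ε, mul_comm P]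

lemma succ_le_numLevels_iff {ε P : ℝ} (hε : 0 < ε) (hP : 0 < P) (x : ℝ) (n : ℕ) :
    n + 1 ≤ numLevels ε P x ↔ ε * (1 + ε) ^ (n + 1) / P ≤ x := by
  rw [← eta_le_budget_iff hε hP]
  have hbdd := bddAbove_setOf_eta_le hε (budget ε P x)
  refine ⟨fun h ↦ ?_, fun h ↦ le_csSup hbdd ⟨by omega, h⟩⟩
  have hne : {n : ℕ | 1 ≤ n ∧ eta ε n ≤ budget ε P x}.Nonempty := by
    by_contra hempty
    rw [numLevels, Set.not_nonempty_iff_eq_empty.mp hempty, csSup_empty] at h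
    simp at h
  have hmem : eta ε (numLevels ε P x) ≤ budget ε P x := (Nat.sSup_mem hne hbdd).2
  have hpow : (1 + ε) ^ (n + 1) ≤ (1 + ε) ^ numLevels ε P x :=
    pow_le_pow_right₀ (by linarith) h
  rw [eta] at hmem ⊢
  linarith

/-- The layer-cake decomposition of a natural number into unit steps. -/
lemma ENNReal.tsum_ite_succ_le (k : ℕ) :
    ∑' n : ℕ, (if n + 1 ≤ k then 1 else 0 : ENNReal) = k := by
  rw [tsum_eq_sum (s := Finset.range k) fun n hn ↦ if_neg (by simpa using hn),
    Finset.sum_congr rfl fun n hn ↦ if_pos (Nat.succ_le_of_lt (Finset.mem_range.mp hn))]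
  simp

lemma expMeasure_Ici {r x : ℝ} (hr : 0 < r) (hx : 0 ≤ x) :
    expMeasure r (Set.Ici x) = ENNReal.ofReal (exp (-(r * x))) := by
  have : IsProbabilityMeasure (expMeasure r) := isProbabilityMeasure_expMeasure hr
  have : NullSingletonClass (expMeasure r) := by
    rw [expMeasure, gammaMeasure]
    infer_instance
  rw [← measure_congr Ioi_ae_eq_Ici, ← Set.compl_Iic, prob_compl_eq_one_sub measurableSet_Iic,
    ← ofReal_cdf, cdf_expMeasure_eq hr, if_pos hx, ← ENNReal.ofReal_one,
    ← ENNReal.ofReal_sub _ (by simpa using mul_nonneg hr.le hx), sub_sub_cancel]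

theorem numLevels_mean_series (Ω : Type*) [MeasurableSpace Ω] (μ : Measure Ω)
    [IsProbabilityMeasure μ] (R : ℝ) (hR : 0 < R) (ε : ℝ) (hε : ε = 2 ^ R - 1)
    (P : ℝ) (hP : 0 < P) (X : Ω → ℝ) (hX : Measurable X)
    (hdist : μ.map X = expMeasure 1) :
    ∫ ω, (numLevels ε P (X ω) : ℝ) ∂μ =
      ∑' n : ℕ, Real.exp (-(ε * (1 + ε) ^ (n + 1)) / P) := by
  have hε0 : 0 < ε := by
    rw [hε, sub_pos]
    exact Real.one_lt_rpow one_lt_two hR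
  let t : ℕ → ℝ := fun n ↦ ε * (1 + ε) ^ (n + 1) / P
  let f : ℕ → Ω → ENNReal := fun n ↦ (X ⁻¹' Set.Ici (t n)).indicator 1
  have hfm (n : ℕ) : Measurable (f n) := measurable_one.indicator (hX measurableSet_Ici)
  have hsum (ω : Ω) : ∑' n, f n ω = numLevels ε P (X ω) := by
    rw [← ENNReal.tsum_ite_succ_le]
    refine tsum_congr fun n ↦ ?_
    simp only [f, succ_le_numLevels_iff hε0 hP]
    split_ifs with h
    · exact Set.indicator_of_mem (s := X ⁻¹' Set.Ici (t n)) h 1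
    · exact Set.indicator_of_notMem (s := X ⁻¹' Set.Ici (t n)) h 1
  have hint (n : ℕ) : ∫⁻ ω, f n ω ∂μ = ENNReal.ofReal (exp (-t n)) := by
    rw [lintegral_indicator_one (hX measurableSet_Ici), ← Measure.map_apply hX measurableSet_Ici,
      hdist, expMeasure_Ici one_pos (by positivity), one_mul]
  calc ∫ ω, (numLevels ε P (X ω) : ℝ) ∂μ
      = ∫ ω, (∑' n, f n ω).toReal ∂μ := by simp only [hsum, ENNReal.toReal_natCast]
    _ = (∫⁻ ω, ∑' n, f n ω ∂μ).toReal :=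
      integral_toReal (Measurable.tsum hfm).aemeasurable
        (ae_of_all _ fun ω ↦ by simp [hsum])
    _ = ∑' n, exp (-t n) := by
      rw [lintegral_tsum fun n ↦ (hfm n).aemeasurable]
      simp only [hint]
      rw [ENNReal.tsum_toReal_eq fun _ ↦ ENNReal.ofReal_ne_top]
      simp only [ENNReal.toReal_ofReal (exp_nonneg _)]
    _ = ∑' n : ℕ, exp (-(ε * (1 + ε) ^ (n + 1)) / P) := by simp only [t, neg_div]
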